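/- Let a, b, c ∈ ℂ with a ∉ ℤ, b ∉ ℤ, c ∉ ℤ and a + b + c = −3, and let α, x, y ∈ ℂ with α ≠ 0, x ≠ 0, y ≠ 0 and x ≠ y. Define the ℂ-linear map ∇ : R × R → R by ∇(f, g) := ∂₁g − ∂₂f + g·(a/u₁ + c/(1+u₁+u₂) + α·x) − f·(b/u₂ + c/(1+u₁+u₂) + α·y). Then the quotient ℂ-vector space R / ∇(R × R) has dimension 3, and the classes of the three functions 1, u₁, u₂ form a basis of it. -/

import Mathlib

/-- `U = {(u₁,u₂) ∈ ℂ² : u₁ ≠ 0, u₂ ≠ 0, 1 + u₁ + u₂ ≠ 0}`. -/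
def Uset : Set (ℂ × ℂ) := {u | u.1 ≠ 0 ∧ u.2 ≠ 0 ∧ 1 + u.1 + u.2 ≠ 0}

/-- The rational function `p / (u₁^i·u₂^j·(1+u₁+u₂)^k)` on `U`. -/
noncomputable def Rform (p : MvPolynomial (Fin 2) ℂ) (i j k : ℕ) : Uset → ℂ :=
  fun u => MvPolynomial.eval (fun n : Fin 2 => if n = 0 then u.1.1 else u.1.2) p /
    (u.1.1 ^ i * u.1.2 ^ j * (1 + u.1.1 + u.1.2) ^ k)

/-- `R`: the space of rational functions on `U` with poles only along
`u₁ = 0`, `u₂ = 0` and `1 + u₁ + u₂ = 0`. -/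
def Rset : Set (Uset → ℂ) :=
  {f | ∃ (p : MvPolynomial (Fin 2) ℂ) (i j k : ℕ), f = Rform p i j k}

open Classical in
/-- First partial derivative of a function on the open set `U`. -/
noncomputable def PD1 (f : Uset → ℂ) : Uset → ℂ :=
  fun u => deriv
    (fun w => if h : (w, u.1.2) ∈ Uset then f ⟨(w, u.1.2), h⟩ else 0) u.1.1

open Classical in
/-- Second partial derivative of a function on the open set `U`. -/
noncomputable def PD2 (f : Uset → ℂ) : Uset → ℂ :=
  fun u => deriv
    (fun w => if h : (u.1.1, w) ∈ Uset then f ⟨(u.1.1, w), h⟩ else 0) u.1.2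

/-- The twisted de Rham differential on 1-forms of the confluent hypergeometric
connection: `∇(f,g) = ∂₁g − ∂₂f + g·(a/u₁ + c/(1+u₁+u₂) + αx) − f·(b/u₂ + c/(1+u₁+u₂) + αy)`. -/
noncomputable def nablaOp (a b c α x y : ℂ) (f g : Uset → ℂ) : Uset → ℂ :=
  fun u => PD1 g u - PD2 f u
    + g u * (a / u.1.1 + c / (1 + u.1.1 + u.1.2) + α * x)
    - f u * (b / u.1.2 + c / (1 + u.1.1 + u.1.2) + α * y)

namespace ConfluentH2

open MvPolynomial

/-- The polynomial `1 + u₁ + u₂`. -/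
noncomputable def linL : MvPolynomial (Fin 2) ℂ := 1 + X 0 + X 1

/-- The polynomial `u₁ u₂ (1 + u₁ + u₂)` cutting out the complement of `U`. -/
noncomputable def polQ : MvPolynomial (Fin 2) ℂ := X 0 * X 1 * linL

/-- The numerator over `polQ` of the twisted differential of the 1-form `P du₁ + S du₂`. -/
noncomputable def twistedD (a b c p q : ℂ) (P S : MvPolynomial (Fin 2) ℂ) :
    MvPolynomial (Fin 2) ℂ :=
  polQ * (pderiv 0 S - pderiv 1 P)
    + S * (C a * (X 1 * linL) + C c * (X 0 * X 1) + C p * polQ)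
    - P * (C b * (X 0 * linL) + C c * (X 0 * X 1) + C q * polQ)

/-- The first component of the twisted differential of `polQ * r`. -/
noncomputable def gradFst (a c p : ℂ) (r : MvPolynomial (Fin 2) ℂ) : MvPolynomial (Fin 2) ℂ :=
  polQ * (pderiv 0 r + C p * r) + r * (C (a + 1) * (X 1 * linL) + C (c + 1) * (X 0 * X 1))

/-- The second component of the twisted differential of `polQ * r`. -/
noncomputable def gradSnd (b c q : ℂ) (r : MvPolynomial (Fin 2) ℂ) : MvPolynomial (Fin 2) ℂ :=
  polQ * (pderiv 1 r + C q * r) + r * (C (b + 1) * (X 0 * linL) + C (c + 1) * (X 0 * X 1))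

@[simp] lemma pderiv_zero_X_one : pderiv (0 : Fin 2) (X 1 : MvPolynomial (Fin 2) ℂ) = 0 :=
  pderiv_X_of_ne (by decide)

@[simp] lemma pderiv_one_X_zero : pderiv (1 : Fin 2) (X 0 : MvPolynomial (Fin 2) ℂ) = 0 :=
  pderiv_X_of_ne (by decide)

@[simp] lemma pderiv_linL (i : Fin 2) : pderiv i linL = 1 := by
  fin_cases i <;> simp [linL]

lemma pderiv_comm (r : MvPolynomial (Fin 2) ℂ) :
    pderiv 0 (pderiv 1 r) = pderiv 1 (pderiv 0 r) := by
  have h : ⁅pderiv (R := ℂ) (0 : Fin 2), pderiv (R := ℂ) (1 : Fin 2)⁆ = 0 := by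
    refine MvPolynomial.derivation_ext fun i => ?_
    fin_cases i <;> simp [Derivation.commutator_apply]
  have := congrArg (fun D => D r) h
  simpa [Derivation.commutator_apply, sub_eq_zero] using this

variable {a b c p q : ℂ} {P S T : MvPolynomial (Fin 2) ℂ}

lemma twistedD_grad (r : MvPolynomial (Fin 2) ℂ) :
    twistedD a b c p q (gradFst a c p r) (gradSnd b c q r) = 0 := by
  simp only [twistedD, gradFst, gradSnd, polQ, map_add, pderiv_mul, pderiv_linL, pderiv_X_self,
    pderiv_zero_X_one, pderiv_one_X_zero, pderiv_C, pderiv_comm, C_1, pderiv_one]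
  ring

lemma twistedD_add (P' S' : MvPolynomial (Fin 2) ℂ) :
    twistedD a b c p q (P + P') (S + S') =
      twistedD a b c p q P S + twistedD a b c p q P' S' := by
  simp only [twistedD, map_add]
  ring

lemma twistedD_C_mul (t : ℂ) :
    twistedD a b c p q (C t * P) (C t * S) = C t * twistedD a b c p q P S := by
  simp only [twistedD, pderiv_C_mul]
  ring

lemma twistedD_X_zero_mul :
    twistedD a b c p q (X 0 * P) (X 0 * S) = X 0 * twistedD (a + 1) b c p q P S := by
  simp only [twistedD, pderiv_mul, pderiv_X_self, pderiv_one_X_zero, map_add, C_1, polQ]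
  ring

lemma twistedD_X_one_mul :
    twistedD a b c p q (X 1 * P) (X 1 * S) = X 1 * twistedD a (b + 1) c p q P S := by
  simp only [twistedD, pderiv_mul, pderiv_X_self, pderiv_zero_X_one, map_add, C_1, polQ]
  ring

lemma twistedD_linL_mul :
    twistedD a b c p q (linL * P) (linL * S) = linL * twistedD a b (c + 1) p q P S := by
  simp only [twistedD, pderiv_mul, pderiv_linL, map_add, C_1, polQ]
  ring

/-! ### Restriction to a line -/

/-- The substitution `u₁ ↦ s₁, u₂ ↦ s₂` is congruent to the identity modulo any `l` for which
`s₁ ≡ u₁` and `s₂ ≡ u₂`. -/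
lemma dvd_sub_aeval {l : MvPolynomial (Fin 2) ℂ} {s : Fin 2 → MvPolynomial (Fin 2) ℂ}
    (h : ∀ i, l ∣ X i - s i) (f : MvPolynomial (Fin 2) ℂ) : l ∣ f - aeval s f := by
  induction f using MvPolynomial.induction_on with
  | C t => simp [algebraMap_eq]
  | add f g hf hg =>
    rw [map_add, add_sub_add_comm]
    exact dvd_add hf hg
  | mul_X f i hf =>
    have : f * X i - aeval s (f * X i) = (f - aeval s f) * X i + aeval s f * (X i - s i) := by
      simp only [map_mul, aeval_X]
      ring
    rw [this]
    exact dvd_add (hf.mul_right _) ((h i).mul_left _)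

/-- The restriction to the line `u₁ = 0`. -/
noncomputable def resX0 : MvPolynomial (Fin 2) ℂ →ₐ[ℂ] MvPolynomial (Fin 2) ℂ :=
  aeval ![0, X 1]

/-- The restriction to the line `u₂ = 0`. -/
noncomputable def resX1 : MvPolynomial (Fin 2) ℂ →ₐ[ℂ] MvPolynomial (Fin 2) ℂ :=
  aeval ![X 0, 0]

/-- The restriction to the line `u₂ = -1 - u₁`. -/
noncomputable def resL : MvPolynomial (Fin 2) ℂ →ₐ[ℂ] MvPolynomial (Fin 2) ℂ :=
  aeval ![X 0, -1 - X 0]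

lemma X_zero_dvd_sub_resX0 (f : MvPolynomial (Fin 2) ℂ) : X 0 ∣ f - resX0 f :=
  dvd_sub_aeval (fun i => by fin_cases i <;> simp) f

lemma X_one_dvd_sub_resX1 (f : MvPolynomial (Fin 2) ℂ) : X 1 ∣ f - resX1 f :=
  dvd_sub_aeval (fun i => by fin_cases i <;> simp) f

lemma linL_dvd_sub_resL (f : MvPolynomial (Fin 2) ℂ) : linL ∣ f - resL f :=
  dvd_sub_aeval (fun i => by
    fin_cases i
    · simp
    · exact ⟨1, by simp [linL]; ring⟩) f

lemma linL_ne_zero : linL ≠ 0 := fun h => by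
  simpa [linL] using congrArg (eval 0) h

lemma polQ_ne_zero : polQ ≠ 0 :=
  mul_ne_zero (mul_ne_zero (X_ne_zero _) (X_ne_zero _)) linL_ne_zero

lemma one_add_X_ne_zero (i : Fin 2) : (1 + X i : MvPolynomial (Fin 2) ℂ) ≠ 0 := fun h => by
  simpa using congrArg (eval 0) h

@[simp] lemma resX0_X_zero : resX0 (X 0) = 0 := by simp [resX0]
@[simp] lemma resX0_X_one : resX0 (X 1) = X 1 := by simp [resX0]
@[simp] lemma resX0_C (t : ℂ) : resX0 (C t) = C t := by simp [resX0, algebraMap_eq]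
@[simp] lemma resX0_linL : resX0 linL = 1 + X 1 := by simp [linL]
@[simp] lemma resX1_X_zero : resX1 (X 0) = X 0 := by simp [resX1]
@[simp] lemma resX1_X_one : resX1 (X 1) = 0 := by simp [resX1]
@[simp] lemma resX1_C (t : ℂ) : resX1 (C t) = C t := by simp [resX1, algebraMap_eq]
@[simp] lemma resX1_linL : resX1 linL = 1 + X 0 := by simp [linL]
@[simp] lemma resL_X_zero : resL (X 0) = X 0 := by simp [resL]
@[simp] lemma resL_X_one : resL (X 1) = -1 - X 0 := by simp [resL]
@[simp] lemma resL_C (t : ℂ) : resL (C t) = C t := by simp [resL, algebraMap_eq]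
@[simp] lemma resL_linL : resL linL = 0 := by simp [linL]

lemma C_ne_zero' {t : ℂ} (h : t ≠ 0) : (C t : MvPolynomial (Fin 2) ℂ) ≠ 0 := by simpa using h

/-! ### The logarithmic conditions -/

lemma X_zero_dvd_snd (ha : a ≠ 0) (h : X 0 ∣ twistedD a b c p q P S) : X 0 ∣ S := by
  obtain ⟨K, hK⟩ := h
  have h := congrArg resX0 hK
  simp [twistedD, polQ, ha, one_add_X_ne_zero] at h
  simpa [h] using X_zero_dvd_sub_resX0 S

lemma X_one_dvd_fst (hb : b ≠ 0) (h : X 1 ∣ twistedD a b c p q P S) : X 1 ∣ P := by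
  obtain ⟨K, hK⟩ := h
  have h := congrArg resX1 hK
  simp [twistedD, polQ, hb, one_add_X_ne_zero] at h
  simpa [h] using X_one_dvd_sub_resX1 P

lemma neg_one_sub_X_ne_zero : (-1 - X 0 : MvPolynomial (Fin 2) ℂ) ≠ 0 := fun h => by
  simpa using congrArg (eval 0) h

lemma linL_dvd_sub (hc : c ≠ 0) (h : linL ∣ twistedD a b c p q P S) : linL ∣ S - P := by
  obtain ⟨K, hK⟩ := h
  have h := congrArg resL hK
  simp [twistedD, polQ] at h
  rw [← sub_mul] at h
  simp [hc, neg_one_sub_X_ne_zero] at h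
  simpa [h] using linL_dvd_sub_resL (S - P)

lemma C_mul_C_inv {t : ℂ} (h : t ≠ 0) : (C t * C t⁻¹ : MvPolynomial (Fin 2) ℂ) = 1 := by
  rw [← C_mul, mul_inv_cancel₀ h, C_1]

/-- Lowering by one the order of vanishing along `u₁ = 0`, up to an exact form. -/
lemma exists_reduce_X_zero (ha : a ≠ 0) (ha' : a + 1 ≠ 0) (hb : b ≠ 0) (hc : c ≠ 0)
    (h : X 0 * polQ ∣ twistedD a b c p q P S) :
    ∃ r P₁ S₁, P = X 0 * P₁ + gradFst a c p r ∧ S = X 0 * S₁ + gradSnd b c q r := by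
  obtain ⟨K, hK⟩ := h
  obtain ⟨g, rfl⟩ := X_zero_dvd_snd ha ⟨_, hK.trans (mul_assoc _ _ _)⟩
  have h : X 1 * linL * (pderiv 0 (X 0 * g) - pderiv 1 P)
      + g * (C a * (X 1 * linL) + C c * (X 0 * X 1) + C p * polQ)
      - P * (C b * linL + C c * X 1 + C q * (X 1 * linL)) = polQ * K := by
    refine mul_left_cancel₀ (X_ne_zero (0 : Fin 2)) ?_
    rw [← mul_assoc (X 0) polQ, ← hK]
    simp only [twistedD, polQ]
    ring
  replace h := congrArg resX0 h
  simp only [map_add, map_sub, map_mul, polQ, resX0_X_zero, resX0_X_one, resX0_linL, resX0_C]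
    at h
  have h1 : X 1 * (1 + X 1) ∣ resX0 P := by
    have hd : X 1 * (1 + X 1) ∣ resX0 P * (C b * (1 + X 1) + C c * X 1
        + C q * (X 1 * (1 + X 1))) :=
      ⟨resX0 (pderiv 0 (X 0 * g)) - resX0 (pderiv 1 P) + resX0 g * C a, by
        linear_combination -h⟩
    refine IsCoprime.dvd_of_dvd_mul_right (IsCoprime.mul_left ?_ ?_) hd
    · exact ⟨-C b⁻¹ * (C b + C c + C q * (1 + X 1)), C b⁻¹, by linear_combination C_mul_C_inv hb⟩
    · exact ⟨C c⁻¹ * (C b + C c + C q * X 1), - C c⁻¹, by linear_combination C_mul_C_inv hc⟩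
  obtain ⟨r, hr⟩ := h1
  obtain ⟨P₁, hP₁⟩ := X_zero_dvd_sub_resX0 P
  set s := C (a + 1)⁻¹ * r
  have hs : C (a + 1) * s = r := by rw [← mul_assoc, C_mul_C_inv ha', one_mul]
  refine ⟨s, P₁ - X 1 * r - X 1 * linL * (pderiv 0 s + C p * s) - s * C (c + 1) * X 1,
    g - (X 1 * linL * (pderiv 1 s + C q * s) + s * (C (b + 1) * linL + C (c + 1) * X 1)), ?_, ?_⟩
  · simp only [gradFst, polQ]
    have hL : linL = 1 + X 0 + X 1 := rfl
    linear_combination hP₁ + hr - X 1 * linL * hs - X 1 * r * hL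
  · simp only [gradSnd, polQ]
    ring

/-- Lowering by one the order of vanishing along `u₂ = 0`, up to an exact form. -/
lemma exists_reduce_X_one (ha : a ≠ 0) (hb : b ≠ 0) (hb' : b + 1 ≠ 0) (hc : c ≠ 0)
    (h : X 1 * polQ ∣ twistedD a b c p q P S) :
    ∃ r P₁ S₁, P = X 1 * P₁ + gradFst a c p r ∧ S = X 1 * S₁ + gradSnd b c q r := by
  obtain ⟨K, hK⟩ := h
  obtain ⟨f, rfl⟩ := X_one_dvd_fst hb ⟨_, hK.trans (mul_assoc _ _ _)⟩
  have h : X 0 * linL * (pderiv 0 S - pderiv 1 (X 1 * f))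
      + S * (C a * linL + C c * X 0 + C p * (X 0 * linL))
      - f * (C b * (X 0 * linL) + C c * (X 0 * X 1) + C q * polQ) = polQ * K := by
    refine mul_left_cancel₀ (X_ne_zero (1 : Fin 2)) ?_
    rw [← mul_assoc (X 1) polQ, ← hK]
    simp only [twistedD, polQ]
    ring
  replace h := congrArg resX1 h
  simp only [map_add, map_sub, map_mul, polQ, resX1_X_zero, resX1_X_one, resX1_linL, resX1_C]
    at h
  have h1 : X 0 * (1 + X 0) ∣ resX1 S := by
    have hd : X 0 * (1 + X 0) ∣ resX1 S * (C a * (1 + X 0) + C c * X 0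
        + C p * (X 0 * (1 + X 0))) :=
      ⟨resX1 (pderiv 1 (X 1 * f)) - resX1 (pderiv 0 S) + resX1 f * C b, by
        linear_combination h⟩
    refine IsCoprime.dvd_of_dvd_mul_right (IsCoprime.mul_left ?_ ?_) hd
    · exact ⟨-C a⁻¹ * (C a + C c + C p * (1 + X 0)), C a⁻¹, by
        linear_combination C_mul_C_inv ha⟩
    · exact ⟨C c⁻¹ * (C a + C c + C p * X 0), - C c⁻¹, by linear_combination C_mul_C_inv hc⟩
  obtain ⟨r, hr⟩ := h1
  obtain ⟨S₁, hS₁⟩ := X_one_dvd_sub_resX1 S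
  set s := C (b + 1)⁻¹ * r
  have hs : C (b + 1) * s = r := by rw [← mul_assoc, C_mul_C_inv hb', one_mul]
  refine ⟨s, f - (X 0 * linL * (pderiv 0 s + C p * s) + s * (C (a + 1) * linL + C (c + 1) * X 0)),
    S₁ - X 0 * r - X 0 * linL * (pderiv 1 s + C q * s) - s * C (c + 1) * X 0, ?_, ?_⟩
  · simp only [gradFst, polQ]
    ring
  · simp only [gradSnd, polQ]
    have hL : linL = 1 + X 0 + X 1 := rfl
    linear_combination hS₁ + hr - X 0 * linL * hs - X 0 * r * hL

/-- Lowering by one the order of vanishing along `1 + u₁ + u₂ = 0`, up to an exact form. -/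
lemma exists_reduce_linL (ha : a ≠ 0) (hb : b ≠ 0) (hc : c ≠ 0) (hc' : c + 1 ≠ 0)
    (h : linL * polQ ∣ twistedD a b c p q P S) :
    ∃ r P₁ S₁, P = linL * P₁ + gradFst a c p r ∧ S = linL * S₁ + gradSnd b c q r := by
  obtain ⟨K, hK⟩ := h
  obtain ⟨w, hw⟩ := linL_dvd_sub hc ⟨_, hK.trans (mul_assoc _ _ _)⟩
  obtain rfl : S = P + linL * w := by linear_combination hw
  have h : X 0 * X 1 * (pderiv 0 (P + linL * w) - pderiv 1 P) + P * (C a * X 1 - C b * X 0)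
      + w * (C a * (X 1 * linL) + C c * (X 0 * X 1) + C p * polQ)
      + P * ((C p - C q) * (X 0 * X 1)) = polQ * K := by
    refine mul_left_cancel₀ linL_ne_zero ?_
    rw [← mul_assoc linL polQ, ← hK]
    simp only [twistedD, polQ]
    ring
  replace h := congrArg resL h
  simp only [map_add, map_sub, map_mul, polQ, resL_X_zero, resL_X_one, resL_linL, resL_C] at h
  have h1 : X 0 * (-1 - X 0) ∣ resL P := by
    have hd : X 0 * (-1 - X 0) ∣ resL P * (C a * (-1 - X 0) - C b * X 0
        + (C p - C q) * (X 0 * (-1 - X 0))) :=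
      ⟨resL (pderiv 1 P) - (resL (pderiv 0 P) + resL (pderiv 0 (linL * w))) - resL w * C c, by
        linear_combination h⟩
    refine IsCoprime.dvd_of_dvd_mul_right (IsCoprime.mul_left ?_ ?_) hd
    · exact ⟨C a⁻¹ * (-C a - C b + (C p - C q) * (-1 - X 0)), -C a⁻¹, by
        linear_combination C_mul_C_inv ha⟩
    · exact ⟨-C b⁻¹ * (C a + C b + (C p - C q) * X 0), C b⁻¹, by
        linear_combination C_mul_C_inv hb⟩
  obtain ⟨r, hr⟩ := h1
  obtain ⟨P₁, hP₁⟩ := linL_dvd_sub_resL P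
  set s := C (c + 1)⁻¹ * r
  have hs : C (c + 1) * s = r := by rw [← mul_assoc, C_mul_C_inv hc', one_mul]
  have hL : linL = 1 + X 0 + X 1 := rfl
  refine ⟨s, P₁ - X 0 * r - (X 0 * X 1 * (pderiv 0 s + C p * s) + s * C (a + 1) * X 1),
    P₁ + w - X 0 * r - (X 0 * X 1 * (pderiv 1 s + C q * s) + s * C (b + 1) * X 0), ?_, ?_⟩
  · simp only [gradFst, polQ]
    linear_combination hP₁ + hr - X 0 * X 1 * hs + X 0 * r * hL
  · simp only [gradSnd, polQ]
    linear_combination hP₁ + hr - X 0 * X 1 * hs + X 0 * r * hL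

variable {n : ℕ} {f : MvPolynomial (Fin 2) ℂ}

/-! ### Degree filtration -/

/-- The polynomials of total degree `< n`. -/
def degLT (n : ℕ) : Submodule ℂ (MvPolynomial (Fin 2) ℂ) where
  carrier := {f | ∀ s, n ≤ s.degree → coeff s f = 0}
  add_mem' hf hg s hs := by simp [hf s hs, hg s hs]
  zero_mem' s _ := by simp
  smul_mem' t f hf s hs := by simp [hf s hs]


lemma degLT_mono {m : ℕ} (h : n ≤ m) (hf : f ∈ degLT n) : f ∈ degLT m :=
  fun s hs => hf s (h.trans hs)

lemma mem_degLT_iff (hf : f ≠ 0) : f ∈ degLT n ↔ f.totalDegree < n := by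
  constructor
  · intro h
    obtain ⟨s, hs, hs'⟩ := Finset.exists_mem_eq_sup f.support (support_nonempty.2 hf)
      (fun s => s.degree)
    have : f.totalDegree = s.degree := hs'
    rw [this]
    by_contra! hlt
    exact mem_support_iff.1 hs (h s hlt)
  · intro h s hs
    by_contra hne
    have : s.degree ≤ f.totalDegree := le_totalDegree (mem_support_iff.2 hne)
    omega

lemma mem_degLT_of_totalDegree_lt (h : f.totalDegree < n) : f ∈ degLT n := by
  rcases eq_or_ne f 0 with rfl | hf
  · exact zero_mem _
  · exact (mem_degLT_iff hf).2 h

lemma exists_mem_degLT (f : MvPolynomial (Fin 2) ℂ) : ∃ n, f ∈ degLT n :=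
  ⟨_, mem_degLT_of_totalDegree_lt (Nat.lt_succ_self _)⟩

lemma C_mul_mem_degLT (t : ℂ) (hf : f ∈ degLT n) : C t * f ∈ degLT n := by
  rw [← smul_eq_C_mul]
  exact Submodule.smul_mem _ _ hf

lemma X_mul_mem_degLT (i : Fin 2) (hf : f ∈ degLT n) : X i * f ∈ degLT (n + 1) := by
  rcases eq_or_ne f 0 with rfl | h0
  · simp
  · refine mem_degLT_of_totalDegree_lt ((totalDegree_mul _ _).trans_lt ?_)
    have := (mem_degLT_iff h0).1 hf
    rw [totalDegree_X]
    omega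

lemma linL_mul_mem_degLT (hf : f ∈ degLT n) : linL * f ∈ degLT (n + 1) := by
  rw [linL, add_mul, add_mul, one_mul]
  exact add_mem (add_mem (degLT_mono n.le_succ hf) (X_mul_mem_degLT 0 hf)) (X_mul_mem_degLT 1 hf)

lemma mem_degLT_of_mul {l : MvPolynomial (Fin 2) ℂ} {k : ℕ} (hl : l ≠ 0)
    (hk : l.totalDegree = k) (h : l * f ∈ degLT (n + k)) : f ∈ degLT n := by
  rcases eq_or_ne f 0 with rfl | h0
  · simp
  · have := (mem_degLT_iff (mul_ne_zero hl h0)).1 h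
    rw [totalDegree_mul_of_isDomain hl h0] at this
    exact mem_degLT_of_totalDegree_lt (by omega)

lemma pderiv_mem_degLT (i : Fin 2) (hf : f ∈ degLT (n + 1)) : pderiv i f ∈ degLT n := by
  intro s hs
  rw [coeff_pderiv, hf _ (by simp; omega)]
  simp

lemma X_mul_pderiv_mem_degLT (i j : Fin 2) (hf : f ∈ degLT n) : X i * pderiv j f ∈ degLT n := by
  cases n with
  | zero =>
    have : f = 0 := by ext s; exact hf s (Nat.zero_le _)
    simp [this]
  | succ n => exact X_mul_mem_degLT i (pderiv_mem_degLT j hf)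

lemma totalDegree_X_add_X : (X 0 + X 1 : MvPolynomial (Fin 2) ℂ).totalDegree = 1 := by
  have h : (X 0 + X 1 : MvPolynomial (Fin 2) ℂ).IsHomogeneous 1 :=
    (isHomogeneous_X _ _).add (isHomogeneous_X _ _)
  refine h.totalDegree fun h => ?_
  simpa using congrArg (eval fun _ => 1) h

lemma totalDegree_linL : linL.totalDegree = 1 := by
  rw [linL, add_assoc, totalDegree_add_eq_right_of_totalDegree_lt, totalDegree_X_add_X]
  simp [totalDegree_X_add_X]

lemma homogeneousComponent_X_mul (i : Fin 2) (f : MvPolynomial (Fin 2) ℂ) :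
    homogeneousComponent (n + 1) (X i * f) = X i * homogeneousComponent n f := by
  ext s
  simp only [coeff_homogeneousComponent, coeff_X_mul']
  by_cases hi : i ∈ s.support
  · have : s.degree = (s - Finsupp.single i 1).degree + 1 := by
      conv_lhs => rw [← Finsupp.sub_add_single_one_cancel (Finsupp.mem_support_iff.1 hi)]
      simp
    simp [hi, this]
  · simp [hi]

lemma homogeneousComponent_eq_zero_of_mem (hf : f ∈ degLT n) : homogeneousComponent n f = 0 := by
  ext s
  rw [coeff_homogeneousComponent]
  split_ifs with h
  · simpa using hf s h.ge
  · simp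

lemma sub_homogeneousComponent_mem (hf : f ∈ degLT (n + 1)) :
    f - homogeneousComponent n f ∈ degLT n := by
  intro s hs
  rw [coeff_sub, coeff_homogeneousComponent]
  split_ifs with h
  · simp
  · simp [hf s (by omega)]

lemma homogeneousComponent_mem_degLT : homogeneousComponent n f ∈ degLT (n + 1) := by
  intro s hs
  rw [coeff_homogeneousComponent, if_neg (by omega)]

lemma exists_eq_C_of_mem_degLT_one (hf : f ∈ degLT 1) : ∃ t, f = C t := by
  rcases eq_or_ne f 0 with rfl | h0
  · exact ⟨0, by simp⟩
  · exact ⟨_, totalDegree_eq_zero_iff_eq_C.1 (Nat.lt_one_iff.1 ((mem_degLT_iff h0).1 hf))⟩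

/-- A form of degree at most one that is logarithmic and vanishes along all three lines is zero. -/
lemma eq_zero_of_mem_degLT_two {f g w : MvPolynomial (Fin 2) ℂ} (hf : X 1 * f ∈ degLT 2)
    (hg : X 0 * g ∈ degLT 2) (hw : X 0 * g - X 1 * f = linL * w) : f = 0 ∧ g = 0 := by
  obtain ⟨s, rfl⟩ := exists_eq_C_of_mem_degLT_one
    (mem_degLT_of_mul (n := 1) (X_ne_zero _) (totalDegree_X _) hf)
  obtain ⟨t, rfl⟩ := exists_eq_C_of_mem_degLT_one
    (mem_degLT_of_mul (n := 1) (X_ne_zero _) (totalDegree_X _) hg)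
  have h1 := congrArg (eval ![-1, 0]) hw
  have h2 := congrArg (eval ![0, -1]) hw
  simp [linL] at h1 h2
  simp [h1, h2]

lemma X_add_X_dvd {e v : MvPolynomial (Fin 2) ℂ} {t : ℂ} (ht : t ≠ 0)
    (h : C t * (X 0 * X 1 * e) = (X 0 + X 1) * v) : X 0 + X 1 ∣ e := by
  have hd : X 0 + X 1 ∣ e - aeval ![X 0, -X 0] e :=
    dvd_sub_aeval (fun i => by
      fin_cases i
      · simp
      · exact ⟨1, by simp; ring⟩) e
  have h' := congrArg (aeval (R := ℂ) ![(X 0 : MvPolynomial (Fin 2) ℂ), -X 0]) h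
  simp only [map_mul, map_add, aeval_X, Matrix.cons_val_zero, Matrix.cons_val_one, aeval_C,
    add_neg_cancel, zero_mul, mul_eq_zero, neg_eq_zero, X_ne_zero, false_or, algebraMap_eq,
    C_eq_zero, ht] at h'
  rwa [h', sub_zero] at hd

/-- A polynomial of degree at most one that is the twisted differential of a polynomial form
is zero. -/
lemma eq_zero_of_twistedD_eq (ha : a ≠ 0) (hb : b ≠ 0) (hc : c ≠ 0) (hp : p ≠ 0) (hq : q ≠ 0)
    (hpq : p ≠ q) (hT : T ∈ degLT 2) (n : ℕ) :
    ∀ P S, P ∈ degLT n → S ∈ degLT n → twistedD a b c p q P S = polQ * T → T = 0 := by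
  induction n using Nat.strong_induction_on with
  | _ n ih =>
  intro P S hP hS h
  obtain ⟨g, rfl⟩ := X_zero_dvd_snd ha ⟨X 1 * linL * T, by rw [h, polQ]; ring⟩
  obtain ⟨f, rfl⟩ := X_one_dvd_fst hb ⟨X 0 * linL * T, by rw [h, polQ]; ring⟩
  obtain ⟨w, hw⟩ := linL_dvd_sub hc ⟨X 0 * X 1 * T, by rw [h, polQ]; ring⟩
  rcases le_or_gt n 2 with hn | hn
  · obtain ⟨rfl, rfl⟩ := eq_zero_of_mem_degLT_two (degLT_mono hn hP) (degLT_mono hn hS) hw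
    have : polQ * T = 0 := by rw [← h]; simp [twistedD]
    exact (mul_eq_zero.1 this).resolve_left polQ_ne_zero
  obtain ⟨k, rfl⟩ : ∃ k, n = k + 3 := ⟨n - 3, by omega⟩
  have hf : f ∈ degLT (k + 2) := mem_degLT_of_mul (X_ne_zero _) (totalDegree_X _) hP
  have hg : g ∈ degLT (k + 2) := mem_degLT_of_mul (X_ne_zero _) (totalDegree_X _) hS
  have hw' : w ∈ degLT (k + 2) := by
    refine mem_degLT_of_mul linL_ne_zero totalDegree_linL ?_
    rw [← hw]
    exact sub_mem hS hP
  have hT' : C p * (X 0 * g) - C q * (X 1 * f) ∈ degLT (k + 2) := by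
    have : C p * (X 0 * g) - C q * (X 1 * f) = T - pderiv 0 (X 0 * g) + pderiv 1 (X 1 * f)
        - C a * g + C b * f - C c * w := by
      refine mul_left_cancel₀ polQ_ne_zero ?_
      simp only [twistedD, polQ] at h ⊢
      linear_combination h - C c * (X 0 * X 1) * hw
    rw [this]
    exact sub_mem (add_mem (sub_mem (add_mem (sub_mem (degLT_mono (by omega) hT)
      (pderiv_mem_degLT 0 hS)) (pderiv_mem_degLT 1 hP)) (C_mul_mem_degLT a hg))
      (C_mul_mem_degLT b hf)) (C_mul_mem_degLT c hw')
  set g₁ := homogeneousComponent (k + 1) g with hg₁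
  set f₁ := homogeneousComponent (k + 1) f with hf₁
  have htop : C p * (X 0 * g₁) = C q * (X 1 * f₁) := by
    have := homogeneousComponent_eq_zero_of_mem hT'
    rwa [map_sub, homogeneousComponent_C_mul, homogeneousComponent_C_mul,
      homogeneousComponent_X_mul, homogeneousComponent_X_mul, sub_eq_zero] at this
  have hwtop : X 0 * g₁ - X 1 * f₁ = (X 0 + X 1) * homogeneousComponent (k + 1) w := by
    have := congrArg (homogeneousComponent (k + 2)) hw
    rw [linL, add_mul, add_mul, one_mul] at this
    simp only [map_sub, map_add, homogeneousComponent_X_mul,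
      homogeneousComponent_eq_zero_of_mem hw', zero_add] at this
    rw [add_mul, ← this]
  have hX : X 0 ∣ f₁ := by
    have h' := congrArg resX0 htop
    simp [hq] at h'
    simpa [h'] using X_zero_dvd_sub_resX0 f₁
  obtain ⟨e, he⟩ := hX
  obtain ⟨r, rfl⟩ : X 0 + X 1 ∣ e := by
    refine X_add_X_dvd (sub_ne_zero.2 hpq.symm) (v := C p * homogeneousComponent (k + 1) w) ?_
    rw [C_sub]
    rw [he] at hwtop htop
    linear_combination C p * hwtop - htop
  have hr : r ∈ degLT k := by
    refine mem_degLT_of_mul (fun h => ?_) totalDegree_X_add_X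
      (mem_degLT_of_mul (X_ne_zero 0) (totalDegree_X 0)
        (he ▸ homogeneousComponent_mem_degLT (n := k + 1) (f := f)))
    simpa [h] using totalDegree_X_add_X
  set s := C p⁻¹ * r with hs
  have hps : C p * s = r := by rw [hs, ← mul_assoc, C_mul_C_inv hp, one_mul]
  have hsk : s ∈ degLT k := C_mul_mem_degLT _ hr
  have hgs : X 0 * g₁ = X 0 * X 1 * (X 0 + X 1) * (C q * s) := by
    refine mul_left_cancel₀ (C_ne_zero' hp) ?_
    linear_combination htop + C q * X 1 * he - C q * X 0 * X 1 * (X 0 + X 1) * hps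
  have hL : linL = 1 + X 0 + X 1 := rfl
  have hlow : ∀ t i, s * (C t * (X i * linL) + C (c + 1) * (X 0 * X 1)) ∈ degLT (k + 2) := by
    intro t i
    have : s * (C t * (X i * linL) + C (c + 1) * (X 0 * X 1))
        = C t * (X i * (linL * s)) + C (c + 1) * (X 0 * (X 1 * s)) := by ring
    rw [this]
    exact add_mem (C_mul_mem_degLT _ (X_mul_mem_degLT _ (linL_mul_mem_degLT hsk)))
      (C_mul_mem_degLT _ (X_mul_mem_degLT _ (X_mul_mem_degLT _ hsk)))
  refine ih (k + 2) (by omega) (X 1 * f - gradFst a c p s) (X 0 * g - gradSnd b c q s) ?_ ?_ ?_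
  · have : X 1 * f - gradFst a c p s = X 1 * (f - f₁) - X 0 * (X 1 * r)
        - X 1 * (linL * (X 0 * pderiv 0 s))
        - s * (C (a + 1) * (X 1 * linL) + C (c + 1) * (X 0 * X 1)) := by
      simp only [gradFst, polQ]
      linear_combination X 1 * he - X 0 * X 1 * linL * hps - X 0 * X 1 * r * hL
    rw [this]
    exact sub_mem (sub_mem (sub_mem (X_mul_mem_degLT _ (sub_homogeneousComponent_mem hf))
      (X_mul_mem_degLT _ (X_mul_mem_degLT _ hr)))
      (X_mul_mem_degLT _ (linL_mul_mem_degLT (X_mul_pderiv_mem_degLT _ _ hsk)))) (hlow _ _)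
  · have : X 0 * g - gradSnd b c q s = X 0 * (g - g₁) - C q * (X 0 * (X 1 * s))
        - X 1 * (linL * (X 0 * pderiv 1 s))
        - s * (C (b + 1) * (X 0 * linL) + C (c + 1) * (X 0 * X 1)) := by
      simp only [gradSnd, polQ]
      linear_combination hgs - X 0 * X 1 * C q * s * hL
    rw [this]
    exact sub_mem (sub_mem (sub_mem (X_mul_mem_degLT _ (sub_homogeneousComponent_mem hg))
      (C_mul_mem_degLT _ (X_mul_mem_degLT _ (X_mul_mem_degLT _ hsk))))
      (X_mul_mem_degLT _ (linL_mul_mem_degLT (X_mul_pderiv_mem_degLT _ _ hsk)))) (hlow _ _)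
  · rw [← h, eq_comm]
    conv_lhs => rw [← sub_add_cancel (X 1 * f) (gradFst a c p s),
      ← sub_add_cancel (X 0 * g) (gradSnd b c q s), twistedD_add, twistedD_grad, add_zero]

lemma twistedD_add_grad (r : MvPolynomial (Fin 2) ℂ) :
    twistedD a b c p q (P + gradFst a c p r) (S + gradSnd b c q r) = twistedD a b c p q P S := by
  rw [twistedD_add, twistedD_grad, add_zero]

/-- A complex number that is not an integer. -/
def NotInt (z : ℂ) : Prop := ∀ m : ℤ, z ≠ m

lemma NotInt.ne_zero {z : ℂ} (h : NotInt z) : z ≠ 0 := by simpa using h 0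

lemma NotInt.add_int {z : ℂ} (h : NotInt z) (k : ℤ) : NotInt (z + k) := fun m hm =>
  h (m - k) (by push_cast; linear_combination hm)

lemma NotInt.add_one {z : ℂ} (h : NotInt z) : NotInt (z + 1) := by simpa using h.add_int 1

lemma NotInt.sub_nat {z : ℂ} (h : NotInt z) (n : ℕ) : NotInt (z - n) := by
  simpa [sub_eq_add_neg] using h.add_int (-n)

/-- A polynomial of degree at most one that is, up to a factor `u₁ ^ i u₂ ^ j (1 + u₁ + u₂) ^ k`,
a twisted differential is zero. -/
lemma eq_zero_of_twistedD_eq_pow (hp : p ≠ 0) (hq : q ≠ 0) (hpq : p ≠ q) (hT : T ∈ degLT 2)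
    (i j k : ℕ) : ∀ a b c P S, NotInt a → NotInt b → NotInt c →
      twistedD a b c p q P S = X 0 ^ i * X 1 ^ j * linL ^ k * polQ * T → T = 0 := by
  induction i with
  | succ i ih =>
    intro a b c P S ha hb hc h
    obtain ⟨r, P₁, S₁, rfl, rfl⟩ := exists_reduce_X_zero ha.ne_zero ha.add_one.ne_zero
      hb.ne_zero hc.ne_zero ⟨X 0 ^ i * X 1 ^ j * linL ^ k * T, by rw [h]; ring⟩
    rw [twistedD_add_grad, twistedD_X_zero_mul] at h
    refine ih _ _ _ P₁ S₁ ha.add_one hb hc (mul_left_cancel₀ (X_ne_zero (0 : Fin 2)) ?_)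
    rw [h]
    ring
  | zero =>
  induction j with
  | succ j ih =>
    intro a b c P S ha hb hc h
    obtain ⟨r, P₁, S₁, rfl, rfl⟩ := exists_reduce_X_one ha.ne_zero hb.ne_zero
      hb.add_one.ne_zero hc.ne_zero ⟨X 1 ^ j * linL ^ k * T, by rw [h]; ring⟩
    rw [twistedD_add_grad, twistedD_X_one_mul] at h
    refine ih _ _ _ P₁ S₁ ha hb.add_one hc (mul_left_cancel₀ (X_ne_zero (1 : Fin 2)) ?_)
    rw [h]
    ring
  | zero =>
  induction k with
  | succ k ih =>
    intro a b c P S ha hb hc h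
    obtain ⟨r, P₁, S₁, rfl, rfl⟩ := exists_reduce_linL ha.ne_zero hb.ne_zero hc.ne_zero
      hc.add_one.ne_zero ⟨linL ^ k * T, by rw [h]; ring⟩
    rw [twistedD_add_grad, twistedD_linL_mul] at h
    refine ih _ _ _ P₁ S₁ ha hb hc.add_one (mul_left_cancel₀ linL_ne_zero ?_)
    rw [h]
    ring
  | zero =>
    intro a b c P S ha hb hc h
    obtain ⟨m, hP⟩ := exists_mem_degLT P
    obtain ⟨n, hS⟩ := exists_mem_degLT S
    exact eq_zero_of_twistedD_eq ha.ne_zero hb.ne_zero hc.ne_zero hp hq hpq hT (max m n) P S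
      (degLT_mono (le_max_left _ _) hP) (degLT_mono (le_max_right _ _) hS) (by simpa using h)

/-! ### Reduction to polynomials of degree at most one -/

/-- The polynomials that are twisted differentials of polynomial forms. -/
noncomputable def exactPol (a b c p q : ℂ) : Submodule ℂ (MvPolynomial (Fin 2) ℂ) where
  carrier := {T | ∃ P S, twistedD a b c p q P S = polQ * T}
  add_mem' := by
    rintro T T' ⟨P, S, h⟩ ⟨P', S', h'⟩
    exact ⟨P + P', S + S', by rw [twistedD_add, h, h', mul_add]⟩
  zero_mem' := ⟨0, 0, by simp [twistedD]⟩
  smul_mem' := by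
    rintro t T ⟨P, S, h⟩
    exact ⟨C t * P, C t * S, by rw [twistedD_C_mul, h, smul_eq_C_mul]; ring⟩

lemma exact_snd (s : MvPolynomial (Fin 2) ℂ) :
    C (a + 1) * (linL * s) + C (c + 1) * (X 0 * s) + X 0 * linL * (pderiv 0 s + C p * s) ∈
      exactPol a b c p q :=
  ⟨0, X 0 * linL * s, by
    simp only [twistedD, polQ, pderiv_mul, pderiv_X_self, pderiv_linL, map_add, map_zero, C_1]
    ring⟩

lemma exact_fst (s : MvPolynomial (Fin 2) ℂ) :
    C (b + 1) * (linL * s) + C (c + 1) * (X 1 * s) + X 1 * linL * (pderiv 1 s + C q * s) ∈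
      exactPol a b c p q :=
  ⟨-(X 1 * linL * s), 0, by
    simp only [twistedD, polQ, pderiv_mul, pderiv_X_self, pderiv_linL, map_add, map_zero, C_1,
      map_neg]
    ring⟩

lemma exact_diag (s : MvPolynomial (Fin 2) ℂ) :
    C (a + 1) * (X 1 * s) - C (b + 1) * (X 0 * s)
      + X 0 * X 1 * (pderiv 0 s - pderiv 1 s + C (p - q) * s) ∈ exactPol a b c p q :=
  ⟨X 0 * X 1 * s, X 0 * X 1 * s, by
    simp only [twistedD, polQ, pderiv_mul, pderiv_X_self, pderiv_zero_X_one, pderiv_one_X_zero,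
      map_add, map_sub, C_1]
    ring⟩

lemma X_zero_mul_mem_exactPol (h : T ∈ exactPol (a + 1) b c p q) :
    X 0 * T ∈ exactPol a b c p q := by
  obtain ⟨P, S, h⟩ := h
  exact ⟨X 0 * P, X 0 * S, by rw [twistedD_X_zero_mul, h]; ring⟩

lemma X_one_mul_mem_exactPol (h : T ∈ exactPol a (b + 1) c p q) :
    X 1 * T ∈ exactPol a b c p q := by
  obtain ⟨P, S, h⟩ := h
  exact ⟨X 1 * P, X 1 * S, by rw [twistedD_X_one_mul, h]; ring⟩

lemma linL_mul_mem_exactPol (h : T ∈ exactPol a b (c + 1) p q) :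
    linL * T ∈ exactPol a b c p q := by
  obtain ⟨P, S, h⟩ := h
  exact ⟨linL * P, linL * S, by rw [twistedD_linL_mul, h]; ring⟩

/-- Every polynomial is divisible by `u₁` modulo exact ones. -/
lemma exists_sub_X_zero_mul_mem (ha : a + 1 ≠ 0) (hc : c + 1 ≠ 0)
    (T : MvPolynomial (Fin 2) ℂ) : ∃ T', T - X 0 * T' ∈ exactPol a b c p q := by
  have hL : linL = 1 + X 0 + X 1 := rfl
  set s := C (c + 1)⁻¹ * T
  have hs : C (c + 1) * s = T := by rw [← mul_assoc, C_mul_C_inv hc, one_mul]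
  set v := T + C (b + 1) * s + X 1 * (pderiv 1 s + C q * s)
  set t := C (a + 1)⁻¹ * v
  have ht : C (a + 1) * t = v := by rw [← mul_assoc, C_mul_C_inv ha, one_mul]
  refine ⟨-T - (C (c + 1) * t + linL * (pderiv 0 t + C p * t)), ?_⟩
  convert sub_mem (exact_snd (a := a) (b := b) (c := c) (p := p) (q := q) t) (exact_fst s) using 1
  linear_combination -T * hL - linL * ht + X 1 * hs

/-- Every polynomial is divisible by `u₂` modulo exact ones. -/
lemma exists_sub_X_one_mul_mem (hb : b + 1 ≠ 0) (hc : c + 1 ≠ 0)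
    (T : MvPolynomial (Fin 2) ℂ) : ∃ T', T - X 1 * T' ∈ exactPol a b c p q := by
  have hL : linL = 1 + X 0 + X 1 := rfl
  set s := C (c + 1)⁻¹ * T
  have hs : C (c + 1) * s = T := by rw [← mul_assoc, C_mul_C_inv hc, one_mul]
  set v := T + C (a + 1) * s + X 0 * (pderiv 0 s + C p * s)
  set t := C (b + 1)⁻¹ * v
  have ht : C (b + 1) * t = v := by rw [← mul_assoc, C_mul_C_inv hb, one_mul]
  refine ⟨-T - (C (c + 1) * t + linL * (pderiv 1 t + C q * t)), ?_⟩
  convert sub_mem (exact_fst (a := a) (b := b) (c := c) (p := p) (q := q) t) (exact_snd s) using 1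
  linear_combination -T * hL - linL * ht + X 0 * hs

/-- Every polynomial is divisible by `1 + u₁ + u₂` modulo exact ones. -/
lemma exists_sub_linL_mul_mem (hc : c + 1 ≠ 0)
    (T : MvPolynomial (Fin 2) ℂ) : ∃ T', T - linL * T' ∈ exactPol a b c p q := by
  have hL : linL = 1 + X 0 + X 1 := rfl
  set s := -(C (c + 1)⁻¹ * T) with hs'
  have hs : C (c + 1) * s = -T := by rw [hs', mul_neg, ← mul_assoc, C_mul_C_inv hc, one_mul]
  refine ⟨T - (C (a + 1) * s + X 0 * (pderiv 0 s + C p * s))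
    - (C (b + 1) * s + X 1 * (pderiv 1 s + C q * s)), ?_⟩
  convert add_mem (exact_snd (a := a) (b := b) (c := c) (p := p) (q := q) s) (exact_fst s) using 1
  linear_combination -T * hL - (X 0 + X 1) * hs

lemma exists_sub_pow_mul_mem (i j k : ℕ) : ∀ a b c T, NotInt a → NotInt b → NotInt c →
    ∃ T', T - X 0 ^ i * X 1 ^ j * linL ^ k * T' ∈ exactPol a b c p q ∧
      ∀ R ∈ exactPol (a + i) (b + j) (c + k) p q,
        X 0 ^ i * X 1 ^ j * linL ^ k * R ∈ exactPol a b c p q := by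
  induction i with
  | succ i ih =>
    intro a b c T ha hb hc
    obtain ⟨T₁, h₁⟩ := exists_sub_X_zero_mul_mem (b := b) (p := p) (q := q) ha.add_one.ne_zero
      hc.add_one.ne_zero T
    obtain ⟨T', h', hR⟩ := ih (a + 1) b c T₁ ha.add_one hb hc
    refine ⟨T', ?_, fun R h => ?_⟩
    · convert add_mem h₁ (X_zero_mul_mem_exactPol h') using 1
      ring
    · convert X_zero_mul_mem_exactPol (hR R (by convert h using 2; push_cast; ring)) using 1
      ring
  | zero =>
  induction j with
  | succ j ih =>
    intro a b c T ha hb hc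
    obtain ⟨T₁, h₁⟩ := exists_sub_X_one_mul_mem (a := a) (p := p) (q := q) hb.add_one.ne_zero
      hc.add_one.ne_zero T
    obtain ⟨T', h', hR⟩ := ih a (b + 1) c T₁ ha hb.add_one hc
    refine ⟨T', ?_, fun R h => ?_⟩
    · convert add_mem h₁ (X_one_mul_mem_exactPol h') using 1
      ring
    · convert X_one_mul_mem_exactPol (hR R (by convert h using 2; push_cast; ring)) using 1
      ring
  | zero =>
  induction k with
  | succ k ih =>
    intro a b c T ha hb hc
    obtain ⟨T₁, h₁⟩ := exists_sub_linL_mul_mem (a := a) (b := b) (p := p) (q := q)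
      hc.add_one.ne_zero T
    obtain ⟨T', h', hR⟩ := ih a b (c + 1) T₁ ha hb hc.add_one
    refine ⟨T', ?_, fun R h => ?_⟩
    · convert add_mem h₁ (linL_mul_mem_exactPol h') using 1
      ring
    · convert linL_mul_mem_exactPol (hR R (by convert h using 2; push_cast; ring)) using 1
      ring
  | zero =>
    intro a b c T _ _ _
    exact ⟨T, by simp, fun R h => by simpa using h⟩

lemma mem_of_C_mul_mem {V : Submodule ℂ (MvPolynomial (Fin 2) ℂ)} {t : ℂ} (ht : t ≠ 0)
    (h : C t * f ∈ V) : f ∈ V := by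
  rw [← smul_eq_C_mul] at h
  exact (Submodule.smul_mem_iff _ ht).1 h

lemma X_pow_mul_X_pow_mem_degLT (i j : ℕ) :
    (X 0 ^ i * X 1 ^ j : MvPolynomial (Fin 2) ℂ) ∈ degLT (i + j + 1) := by
  refine mem_degLT_of_totalDegree_lt ((totalDegree_mul _ _).trans_lt ?_)
  simp [totalDegree_X_pow]

lemma degLT_le_of_monomials {V : Submodule ℂ (MvPolynomial (Fin 2) ℂ)}
    (h : ∀ i j, i + j < n → (X 0 ^ i * X 1 ^ j : MvPolynomial (Fin 2) ℂ) ∈ V) : degLT n ≤ V := by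
  intro f hf
  rw [f.as_sum]
  refine sum_mem fun s hs => ?_
  have hdeg : s.degree < n := by
    by_contra! hlt
    exact mem_support_iff.1 hs (hf s hlt)
  have : monomial s (coeff s f) = coeff s f • (X 0 ^ s 0 * X 1 ^ s 1) := by
    rw [monomial_eq, smul_eq_C_mul, Finsupp.prod_fintype _ _ (by simp), Fin.prod_univ_two]
  rw [this]
  refine Submodule.smul_mem _ _ (h _ _ ?_)
  simpa [Finsupp.degree_eq_sum] using hdeg

/-- Modulo exact ones, polynomials are spanned by `1, u₁, u₂`. -/
lemma degLT_le_exactPol_sup (hp : p ≠ 0) (hq : q ≠ 0) (hpq : p ≠ q) (n : ℕ) :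
    degLT n ≤ exactPol a b c p q ⊔ Submodule.span ℂ {1, X 0, X 1} := by
  set V := exactPol a b c p q ⊔ Submodule.span ℂ {1, X 0, X 1}
  have hV : exactPol a b c p q ≤ V := le_sup_left
  have hspan : ∀ f ∈ ({1, X 0, X 1} : Set (MvPolynomial (Fin 2) ℂ)), f ∈ V := fun f hf =>
    (le_sup_right : _ ≤ V) (Submodule.subset_span hf)
  have hL : linL = 1 + X 0 + X 1 := rfl
  induction n with
  | zero => exact degLT_le_of_monomials (by simp)
  | succ n ih =>
  have hdiag : ∀ k s, k + 1 ≤ n → s ∈ degLT k → X 0 * X 1 * s ∈ V := by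
    intro k s hk hs
    refine mem_of_C_mul_mem (sub_ne_zero.2 hpq) ?_
    have : C (p - q) * (X 0 * X 1 * s) = (C (a + 1) * (X 1 * s) - C (b + 1) * (X 0 * s)
        + X 0 * X 1 * (pderiv 0 s - pderiv 1 s + C (p - q) * s))
        - (C (a + 1) * (X 1 * s) - C (b + 1) * (X 0 * s)
          + X 1 * (X 0 * pderiv 0 s) - X 1 * (X 0 * pderiv 1 s)) := by ring
    rw [this]
    refine sub_mem (hV (exact_diag s)) (ih (degLT_mono hk ?_))
    exact sub_mem (add_mem (sub_mem (C_mul_mem_degLT _ (X_mul_mem_degLT _ hs))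
      (C_mul_mem_degLT _ (X_mul_mem_degLT _ hs)))
      (X_mul_mem_degLT _ (X_mul_pderiv_mem_degLT _ _ hs)))
      (X_mul_mem_degLT _ (X_mul_pderiv_mem_degLT _ _ hs))
  have hfst : ∀ k s, k + 1 ≤ n → s ∈ degLT k → X 0 * X 0 * s ∈ V := by
    intro k s hk hs
    refine mem_of_C_mul_mem hp ?_
    have : C p * (X 0 * X 0 * s) = (C (a + 1) * (linL * s) + C (c + 1) * (X 0 * s)
        + X 0 * linL * (pderiv 0 s + C p * s))
        - (C (a + 1) * (linL * s) + C (c + 1) * (X 0 * s) + linL * (X 0 * pderiv 0 s)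
          + C p * (X 0 * s)) - C p * (X 0 * X 1 * s) := by
      linear_combination -X 0 * C p * s * hL
    rw [this]
    refine sub_mem (sub_mem (hV (exact_snd s)) (ih (degLT_mono hk ?_))) ?_
    · exact add_mem (add_mem (add_mem (C_mul_mem_degLT _ (linL_mul_mem_degLT hs))
        (C_mul_mem_degLT _ (X_mul_mem_degLT _ hs)))
        (linL_mul_mem_degLT (X_mul_pderiv_mem_degLT _ _ hs)))
        (C_mul_mem_degLT _ (X_mul_mem_degLT _ hs))
    · rw [← smul_eq_C_mul]
      exact Submodule.smul_mem _ _ (hdiag k s hk hs)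
  have hsnd : ∀ k s, k + 1 ≤ n → s ∈ degLT k → X 1 * X 1 * s ∈ V := by
    intro k s hk hs
    refine mem_of_C_mul_mem hq ?_
    have : C q * (X 1 * X 1 * s) = (C (b + 1) * (linL * s) + C (c + 1) * (X 1 * s)
        + X 1 * linL * (pderiv 1 s + C q * s))
        - (C (b + 1) * (linL * s) + C (c + 1) * (X 1 * s) + linL * (X 1 * pderiv 1 s)
          + C q * (X 1 * s)) - C q * (X 0 * X 1 * s) := by
      linear_combination -X 1 * C q * s * hL
    rw [this]
    refine sub_mem (sub_mem (hV (exact_fst s)) (ih (degLT_mono hk ?_))) ?_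
    · exact add_mem (add_mem (add_mem (C_mul_mem_degLT _ (linL_mul_mem_degLT hs))
        (C_mul_mem_degLT _ (X_mul_mem_degLT _ hs)))
        (linL_mul_mem_degLT (X_mul_pderiv_mem_degLT _ _ hs)))
        (C_mul_mem_degLT _ (X_mul_mem_degLT _ hs))
    · rw [← smul_eq_C_mul]
      exact Submodule.smul_mem _ _ (hdiag k s hk hs)
  refine degLT_le_of_monomials fun i j hij => ?_
  match i, j, hij with
  | 0, 0, _ => exact hspan _ (by simp)
  | 1, 0, _ => exact hspan _ (by simp)
  | 0, 1, _ => exact hspan _ (by simp)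
  | i + 1, j + 1, hij =>
    convert hdiag (i + j + 1) _ (by omega) (X_pow_mul_X_pow_mem_degLT i j) using 1
    ring
  | i + 2, 0, hij =>
    convert hfst (i + 0 + 1) _ (by omega) (X_pow_mul_X_pow_mem_degLT i 0) using 1
    ring
  | 0, j + 2, hij =>
    convert hsnd (0 + j + 1) _ (by omega) (X_pow_mul_X_pow_mem_degLT 0 j) using 1
    ring

/-- Every polynomial is, modulo exact ones, `u₁ ^ n u₂ ^ n (1 + u₁ + u₂) ^ n` times a polynomial
of degree at most one. -/
lemma exists_sub_affine_mem (hp : p ≠ 0) (hq : q ≠ 0) (hpq : p ≠ q) (ha : NotInt a)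
    (hb : NotInt b) (hc : NotInt c) (n : ℕ) (T : MvPolynomial (Fin 2) ℂ) :
    ∃ c₀ c₁ c₂ : ℂ, T - polQ ^ n * (C c₀ + C c₁ * X 0 + C c₂ * X 1) ∈ exactPol a b c p q := by
  obtain ⟨T', h, hR⟩ := exists_sub_pow_mul_mem (p := p) (q := q) n n n a b c T ha hb hc
  obtain ⟨m, hm⟩ := exists_mem_degLT T'
  obtain ⟨E, hE, A, hA, hEA⟩ := Submodule.mem_sup.1
    (degLT_le_exactPol_sup (a := a + n) (b := b + n) (c := c + n) hp hq hpq m hm)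
  obtain ⟨c₀, c₁, c₂, rfl⟩ := Submodule.mem_span_triple.1 hA
  refine ⟨c₀, c₁, c₂, ?_⟩
  convert add_mem h (hR E hE) using 1
  rw [← hEA]
  simp only [smul_eq_C_mul, polQ]
  ring

/-! ### Rational functions on `U` -/

/-- Evaluation of polynomials at a point of `ℂ × ℂ`. -/
noncomputable def evalAt (u : ℂ × ℂ) : MvPolynomial (Fin 2) ℂ →+* ℂ :=
  eval (fun n : Fin 2 => if n = 0 then u.1 else u.2)

@[simp] lemma evalAt_X_zero (u : ℂ × ℂ) : evalAt u (X 0) = u.1 := by simp [evalAt]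
@[simp] lemma evalAt_X_one (u : ℂ × ℂ) : evalAt u (X 1) = u.2 := by simp [evalAt]
@[simp] lemma evalAt_C (u : ℂ × ℂ) (t : ℂ) : evalAt u (C t) = t := by simp [evalAt]
@[simp] lemma evalAt_linL (u : ℂ × ℂ) : evalAt u linL = 1 + u.1 + u.2 := by simp [linL]

lemma evalAt_polQ (u : ℂ × ℂ) : evalAt u polQ = u.1 * u.2 * (1 + u.1 + u.2) := by simp [polQ]

lemma mem_Uset_iff (u : ℂ × ℂ) : u ∈ Uset ↔ evalAt u polQ ≠ 0 := by
  simp [Uset, evalAt_polQ, and_assoc]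

lemma evalAt_polQ_ne_zero (u : Uset) : evalAt u polQ ≠ 0 := (mem_Uset_iff u).1 u.2

lemma eq_of_evalAt_eq {P S : MvPolynomial (Fin 2) ℂ}
    (h : ∀ u : Uset, evalAt u P = evalAt u S) : P = S := by
  refine mul_left_cancel₀ polQ_ne_zero (MvPolynomial.funext fun v => ?_)
  have hv : eval v = evalAt (v 0, v 1) := by
    unfold evalAt
    congr
    funext i
    fin_cases i <;> simp
  rw [hv, map_mul, map_mul]
  by_cases hu : (v 0, v 1) ∈ Uset
  · rw [h ⟨_, hu⟩]
  · rw [mem_Uset_iff, not_not] at hu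
    rw [hu, zero_mul, zero_mul]

/-- The rational function `P / (u₁ u₂ (1 + u₁ + u₂)) ^ n` on `U`. -/
noncomputable def frac (P : MvPolynomial (Fin 2) ℂ) (n : ℕ) : Uset → ℂ :=
  fun u => evalAt u P / evalAt u polQ ^ n

lemma frac_eq_frac_add (P : MvPolynomial (Fin 2) ℂ) (n m : ℕ) :
    frac P n = frac (polQ ^ m * P) (n + m) := by
  funext u
  have := evalAt_polQ_ne_zero u
  simp only [frac, map_mul, map_pow, pow_add]
  field_simp

lemma frac_add (P S : MvPolynomial (Fin 2) ℂ) (n : ℕ) : frac P n + frac S n = frac (P + S) n := by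
  funext u
  simp [frac, add_div]

lemma smul_frac (t : ℂ) (P : MvPolynomial (Fin 2) ℂ) (n : ℕ) :
    t • frac P n = frac (C t * P) n := by
  funext u
  simp [frac, mul_div_assoc]

lemma frac_injective {P S : MvPolynomial (Fin 2) ℂ} {n : ℕ} (h : frac P n = frac S n) :
    P = S := by
  refine eq_of_evalAt_eq fun u => ?_
  have := congrFun h u
  simpa [frac, div_left_inj' (pow_ne_zero n (evalAt_polQ_ne_zero u))] using this

lemma mem_Rset_iff (f : Uset → ℂ) : f ∈ Rset ↔ ∃ P n, f = frac P n := by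
  constructor
  · rintro ⟨P, i, j, k, rfl⟩
    refine ⟨X 0 ^ (j + k) * X 1 ^ (i + k) * linL ^ (i + j) * P, i + j + k, ?_⟩
    funext ⟨u, h1, h2, h3⟩
    simp only [Rform, frac, map_mul, map_pow, evalAt_X_zero, evalAt_X_one, evalAt_linL,
      evalAt_polQ]
    change evalAt u P / _ = _
    rw [div_eq_div_iff (by positivity) (by positivity)]
    simp only [mul_pow]
    ring
  · rintro ⟨P, n, rfl⟩
    exact ⟨P, n, n, n, by funext u; simp only [Rform, frac, evalAt_polQ, mul_pow]; rfl⟩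

lemma exists_common_frac {f g : Uset → ℂ} (hf : f ∈ Rset) (hg : g ∈ Rset) :
    ∃ P S n, f = frac P n ∧ g = frac S n := by
  obtain ⟨P, n, rfl⟩ := (mem_Rset_iff f).1 hf
  obtain ⟨S, m, rfl⟩ := (mem_Rset_iff g).1 hg
  exact ⟨_, _, n + m, frac_eq_frac_add P n m, by rw [add_comm n m]; exact frac_eq_frac_add S m n⟩

lemma hasDerivAt_evalAt_fst (P : MvPolynomial (Fin 2) ℂ) (u : ℂ × ℂ) :
    HasDerivAt (fun w => evalAt (w, u.2) P) (evalAt u (pderiv 0 P)) u.1 := by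
  induction P using MvPolynomial.induction_on with
  | C t => simpa using hasDerivAt_const u.1 t
  | add P S hP hS =>
    simp only [map_add]
    exact hP.fun_add hS
  | mul_X P i hP =>
    obtain rfl | rfl : i = 0 ∨ i = 1 := by fin_cases i <;> simp
    · simpa [pderiv_mul, mul_comm, add_comm] using hP.fun_mul (hasDerivAt_id' u.1)
    · simpa [pderiv_mul, mul_comm] using hP.mul_const u.2

lemma hasDerivAt_evalAt_snd (P : MvPolynomial (Fin 2) ℂ) (u : ℂ × ℂ) :
    HasDerivAt (fun w => evalAt (u.1, w) P) (evalAt u (pderiv 1 P)) u.2 := by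
  induction P using MvPolynomial.induction_on with
  | C t => simpa using hasDerivAt_const u.2 t
  | add P S hP hS =>
    simp only [map_add]
    exact hP.fun_add hS
  | mul_X P i hP =>
    obtain rfl | rfl : i = 0 ∨ i = 1 := by fin_cases i <;> simp
    · simpa [pderiv_mul, mul_comm] using hP.mul_const u.1
    · simpa [pderiv_mul, mul_comm, add_comm] using hP.fun_mul (hasDerivAt_id' u.2)

lemma isOpen_Uset : IsOpen Uset := by
  have : Uset = {u : ℂ × ℂ | u.1 * u.2 * (1 + u.1 + u.2) ≠ 0} := by
    ext u
    rw [mem_Uset_iff, evalAt_polQ]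
    rfl
  rw [this]
  exact isOpen_ne_fun (by fun_prop) (by fun_prop)

open Classical in
lemma PD1_frac (P : MvPolynomial (Fin 2) ℂ) (n : ℕ) :
    PD1 (frac P n) = frac (polQ * pderiv 0 P - C (n : ℂ) * P * pderiv 0 polQ) (n + 1) := by
  funext u
  have hQ := evalAt_polQ_ne_zero u
  have hev : (fun w => if h : (w, u.1.2) ∈ Uset then frac P n ⟨(w, u.1.2), h⟩ else 0)
      =ᶠ[nhds u.1.1] fun w => evalAt (w, u.1.2) P / evalAt (w, u.1.2) polQ ^ n := by
    have ho : IsOpen {w : ℂ | (w, u.1.2) ∈ Uset} := isOpen_Uset.preimage (by fun_prop)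
    filter_upwards [ho.mem_nhds u.2] with w hw
    rw [dif_pos hw]
    rfl
  rw [PD1, hev.deriv_eq, ((hasDerivAt_evalAt_fst P u).fun_div
    ((hasDerivAt_evalAt_fst polQ u).fun_pow n) (pow_ne_zero n hQ)).deriv]
  simp only [frac, map_sub, map_mul, evalAt_C]
  rw [div_eq_div_iff (by positivity) (by positivity)]
  cases n with
  | zero => simp; ring
  | succ n => simp only [Nat.add_sub_cancel]; ring

open Classical in
lemma PD2_frac (P : MvPolynomial (Fin 2) ℂ) (n : ℕ) :
    PD2 (frac P n) = frac (polQ * pderiv 1 P - C (n : ℂ) * P * pderiv 1 polQ) (n + 1) := by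
  funext u
  have hQ := evalAt_polQ_ne_zero u
  have hev : (fun w => if h : (u.1.1, w) ∈ Uset then frac P n ⟨(u.1.1, w), h⟩ else 0)
      =ᶠ[nhds u.1.2] fun w => evalAt (u.1.1, w) P / evalAt (u.1.1, w) polQ ^ n := by
    have ho : IsOpen {w : ℂ | (u.1.1, w) ∈ Uset} := isOpen_Uset.preimage (by fun_prop)
    filter_upwards [ho.mem_nhds u.2] with w hw
    rw [dif_pos hw]
    rfl
  rw [PD2, hev.deriv_eq, ((hasDerivAt_evalAt_snd P u).fun_div
    ((hasDerivAt_evalAt_snd polQ u).fun_pow n) (pow_ne_zero n hQ)).deriv]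
  simp only [frac, map_sub, map_mul, evalAt_C]
  rw [div_eq_div_iff (by positivity) (by positivity)]
  cases n with
  | zero => simp; ring
  | succ n => simp only [Nat.add_sub_cancel]; ring

lemma nablaOp_frac (a b c α x y : ℂ) (P S : MvPolynomial (Fin 2) ℂ) (n : ℕ) :
    nablaOp a b c α x y (frac P n) (frac S n) =
      frac (twistedD (a - n) (b - n) (c - n) (α * x) (α * y) P S) (n + 1) := by
  funext u
  obtain ⟨h1, h2, h3⟩ := u.2
  rw [nablaOp, PD1_frac, PD2_frac]
  simp only [frac, twistedD, polQ, map_sub, map_add, map_mul, evalAt_X_zero, evalAt_X_one,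
    evalAt_linL, evalAt_C, pderiv_mul, pderiv_X_self, pderiv_zero_X_one, pderiv_one_X_zero,
    pderiv_linL, map_zero, map_one]
  field_simp
  ring

variable {α x y : ℂ}

/-- The space `R` of rational functions on `U`, as a submodule. -/
def ratFun : Submodule ℂ (Uset → ℂ) where
  carrier := Rset
  add_mem' := by
    intro f g hf hg
    obtain ⟨P, S, n, rfl, rfl⟩ := exists_common_frac hf hg
    exact (mem_Rset_iff _).2 ⟨_, n, frac_add P S n⟩
  zero_mem' := (mem_Rset_iff _).2 ⟨0, 0, by funext u; simp [frac]⟩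
  smul_mem' := by
    intro t f hf
    obtain ⟨P, n, rfl⟩ := (mem_Rset_iff f).1 hf
    exact (mem_Rset_iff _).2 ⟨_, n, smul_frac t P n⟩

lemma frac_mem_Rset (P : MvPolynomial (Fin 2) ℂ) (n : ℕ) : frac P n ∈ Rset :=
  (mem_Rset_iff _).2 ⟨P, n, rfl⟩

lemma nablaOp_add {g h g' h' : Uset → ℂ} (hg : g ∈ Rset) (hh : h ∈ Rset) (hg' : g' ∈ Rset)
    (hh' : h' ∈ Rset) : nablaOp a b c α x y (g + g') (h + h') =
      nablaOp a b c α x y g h + nablaOp a b c α x y g' h' := by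
  obtain ⟨P, S, n, rfl, rfl⟩ := exists_common_frac hg hh
  obtain ⟨P', S', m, rfl, rfl⟩ := exists_common_frac hg' hh'
  rw [frac_eq_frac_add P n m, frac_eq_frac_add S n m, frac_eq_frac_add P' m n,
    frac_eq_frac_add S' m n, add_comm m n]
  simp only [frac_add, nablaOp_frac, twistedD_add]

lemma nablaOp_smul (t : ℂ) {g h : Uset → ℂ} (hg : g ∈ Rset) (hh : h ∈ Rset) :
    nablaOp a b c α x y (t • g) (t • h) = t • nablaOp a b c α x y g h := by
  obtain ⟨P, S, n, rfl, rfl⟩ := exists_common_frac hg hh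
  simp only [smul_frac, nablaOp_frac, twistedD_C_mul]

/-- The image of the twisted differential, as a submodule. -/
def exactFun (a b c α x y : ℂ) : Submodule ℂ (Uset → ℂ) where
  carrier := {f | ∃ g h : Uset → ℂ, g ∈ Rset ∧ h ∈ Rset ∧ f = nablaOp a b c α x y g h}
  add_mem' := by
    rintro _ _ ⟨g, h, hg, hh, rfl⟩ ⟨g', h', hg', hh', rfl⟩
    exact ⟨_, _, ratFun.add_mem hg hg', ratFun.add_mem hh hh', (nablaOp_add hg hh hg' hh').symm⟩
  zero_mem' := by
    have h0 : (0 : Uset → ℂ) ∈ Rset := ratFun.zero_mem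
    refine ⟨0, 0, h0, h0, ?_⟩
    simpa using (nablaOp_smul (a := a) (b := b) (c := c) (α := α) (x := x) (y := y) 0 h0 h0).symm
  smul_mem' := by
    rintro t _ ⟨g, h, hg, hh, rfl⟩
    exact ⟨_, _, ratFun.smul_mem t hg, ratFun.smul_mem t hh, (nablaOp_smul t hg hh).symm⟩

lemma exactFun_le_ratFun : exactFun a b c α x y ≤ ratFun := by
  rintro _ ⟨g, h, hg, hh, rfl⟩
  obtain ⟨P, S, n, rfl, rfl⟩ := exists_common_frac hg hh
  rw [nablaOp_frac]
  exact frac_mem_Rset _ _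

lemma affine_eq_frac (c₀ c₁ c₂ : ℂ) (n : ℕ) :
    (fun u : Uset => c₀ + c₁ * u.1.1 + c₂ * u.1.2) =
      frac (polQ ^ n * (C c₀ + C c₁ * X 0 + C c₂ * X 1)) n := by
  have h := frac_eq_frac_add (C c₀ + C c₁ * X 0 + C c₂ * X 1) 0 n
  rw [zero_add] at h
  rw [← h]
  funext u
  simp [frac]

lemma exists_eq_affine_add_nablaOp (ha : NotInt a) (hb : NotInt b) (hc : NotInt c)
    (hx : α * x ≠ 0) (hy : α * y ≠ 0) (hxy : α * x ≠ α * y) {f : Uset → ℂ} (hf : f ∈ Rset) :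
    ∃ c₀ c₁ c₂ : ℂ, ∃ g h : Uset → ℂ, g ∈ Rset ∧ h ∈ Rset ∧
      f = (fun u : Uset => c₀ + c₁ * u.1.1 + c₂ * u.1.2) + nablaOp a b c α x y g h := by
  obtain ⟨T, n, rfl⟩ := (mem_Rset_iff f).1 hf
  obtain ⟨c₀, c₁, c₂, P, S, hPS⟩ :=
    exists_sub_affine_mem hx hy hxy (ha.sub_nat n) (hb.sub_nat n) (hc.sub_nat n) n T
  refine ⟨c₀, c₁, c₂, _, _, frac_mem_Rset P n, frac_mem_Rset S n, ?_⟩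
  rw [nablaOp_frac, hPS, affine_eq_frac _ _ _ (n + 1), frac_add, frac_eq_frac_add T n 1]
  congr 1
  ring

lemma affine_mem_degLT (c₀ c₁ c₂ : ℂ) :
    (C c₀ + C c₁ * X 0 + C c₂ * X 1 : MvPolynomial (Fin 2) ℂ) ∈ degLT 2 :=
  add_mem (add_mem (mem_degLT_of_totalDegree_lt (by simp))
    (C_mul_mem_degLT _ (mem_degLT_of_totalDegree_lt (by simp))))
    (C_mul_mem_degLT _ (mem_degLT_of_totalDegree_lt (by simp)))

lemma eq_zero_of_affine_eq_nablaOp (ha : NotInt a) (hb : NotInt b) (hc : NotInt c)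
    (hx : α * x ≠ 0) (hy : α * y ≠ 0) (hxy : α * x ≠ α * y) {c₀ c₁ c₂ : ℂ} {g h : Uset → ℂ}
    (hg : g ∈ Rset) (hh : h ∈ Rset)
    (heq : (fun u : Uset => c₀ + c₁ * u.1.1 + c₂ * u.1.2) = nablaOp a b c α x y g h) :
    c₀ = 0 ∧ c₁ = 0 ∧ c₂ = 0 := by
  obtain ⟨P, S, n, rfl, rfl⟩ := exists_common_frac hg hh
  rw [nablaOp_frac, affine_eq_frac _ _ _ (n + 1)] at heq
  have hA := eq_zero_of_twistedD_eq_pow hx hy hxy (affine_mem_degLT c₀ c₁ c₂) n n n _ _ _ P S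
    (ha.sub_nat n) (hb.sub_nat n) (hc.sub_nat n) (by
      rw [← frac_injective heq, pow_succ]
      simp only [polQ, mul_pow])
  have h0 := congrArg (evalAt (0, 0)) hA
  have h1 := congrArg (evalAt (1, 0)) hA
  have h2 := congrArg (evalAt (0, 1)) hA
  simp only [map_add, map_mul, evalAt_C, evalAt_X_zero, evalAt_X_one, map_zero, mul_zero, mul_one,
    add_zero] at h0 h1 h2
  simp_all

lemma finrank_ratFun_quotient (ha : NotInt a) (hb : NotInt b) (hc : NotInt c)
    (hx : α * x ≠ 0) (hy : α * y ≠ 0) (hxy : α * x ≠ α * y) :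
    Module.finrank ℂ (ratFun ⧸ (exactFun a b c α x y).comap ratFun.subtype) = 3 := by
  have hmem (c₀ c₁ c₂ : ℂ) : (fun u : Uset => c₀ + c₁ * u.1.1 + c₂ * u.1.2) ∈ ratFun := by
    rw [affine_eq_frac _ _ _ 0]
    exact frac_mem_Rset _ _
  let e (t : Fin 3 → ℂ) : ratFun := ⟨_, hmem (t 0) (t 1) (t 2)⟩
  let E : (Fin 3 → ℂ) →ₗ[ℂ] ratFun :=
    { toFun := e
      map_add' := fun s t => by
        ext u
        simp only [e, Pi.add_apply, Submodule.coe_add]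
        ring
      map_smul' := fun r t => by
        ext u
        simp only [e, Pi.smul_apply, smul_eq_mul, RingHom.id_apply, Submodule.coe_smul]
        ring }
  let φ := ((exactFun a b c α x y).comap ratFun.subtype).mkQ ∘ₗ E
  have hinj : Function.Injective φ := by
    refine (injective_iff_map_eq_zero φ).2 fun t ht => ?_
    obtain ⟨g, h, hg, hh, heq⟩ := (Submodule.Quotient.mk_eq_zero _).1 ht
    obtain ⟨h0, h1, h2⟩ := eq_zero_of_affine_eq_nablaOp ha hb hc hx hy hxy hg hh heq
    funext i
    fin_cases i
    exacts [h0, h1, h2]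
  have hsurj : Function.Surjective φ := by
    intro z
    obtain ⟨f, rfl⟩ := Submodule.Quotient.mk_surjective _ z
    obtain ⟨c₀, c₁, c₂, g, h, hg, hh, heq⟩ :=
      exists_eq_affine_add_nablaOp ha hb hc hx hy hxy f.2
    refine ⟨![c₀, c₁, c₂], ((Submodule.Quotient.eq _).2 ?_).symm⟩
    exact ⟨g, h, hg, hh, sub_eq_iff_eq_add'.2 heq⟩
  rw [← (LinearEquiv.ofBijective φ ⟨hinj, hsurj⟩).finrank_eq, Module.finrank_fin_fun]

end ConfluentH2

/-- The claim from the introduction of the paper: the top de Rham cohomology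
`R / ∇(R × R)` of the two-dimensional confluent hypergeometric connection has
dimension `3`, with basis the classes of `1`, `u₁`, `u₂`. -/
theorem confluent_hypergeometric_H2_dim_three (a b c α x y : ℂ)
    (ha : a ∉ Set.range (Int.cast : ℤ → ℂ))
    (hb : b ∉ Set.range (Int.cast : ℤ → ℂ))
    (hc : c ∉ Set.range (Int.cast : ℤ → ℂ))
    (habc : a + b + c = -3)
    (hα : α ≠ 0) (hx : x ≠ 0) (hy : y ≠ 0) (hxy : x ≠ y) :
    ∃ RS NS : Submodule ℂ (Uset → ℂ),
      (∀ f : Uset → ℂ, f ∈ RS ↔ f ∈ Rset) ∧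
      (∀ f : Uset → ℂ, f ∈ NS ↔
        ∃ g h : Uset → ℂ, g ∈ Rset ∧ h ∈ Rset ∧ f = nablaOp a b c α x y g h) ∧
      NS ≤ RS ∧
      Module.finrank ℂ (RS ⧸ NS.comap RS.subtype) = 3 ∧
      -- the classes of 1, u₁, u₂ span the quotient
      (∀ f ∈ Rset, ∃ c₀ c₁ c₂ : ℂ, ∃ g h : Uset → ℂ, g ∈ Rset ∧ h ∈ Rset ∧
        f = (fun u : Uset => c₀ + c₁ * u.1.1 + c₂ * u.1.2) + nablaOp a b c α x y g h) ∧
      -- the classes of 1, u₁, u₂ are linearly independent in the quotient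
      (∀ c₀ c₁ c₂ : ℂ,
        (∃ g h : Uset → ℂ, g ∈ Rset ∧ h ∈ Rset ∧
          (fun u : Uset => c₀ + c₁ * u.1.1 + c₂ * u.1.2) = nablaOp a b c α x y g h) →
        c₀ = 0 ∧ c₁ = 0 ∧ c₂ = 0) := by
  have notInt {z : ℂ} (hz : z ∉ Set.range (Int.cast : ℤ → ℂ)) : ConfluentH2.NotInt z :=
    fun m hm => hz ⟨m, hm.symm⟩
  have hαx := mul_ne_zero hα hx
  have hαy := mul_ne_zero hα hy
  have hαxy : α * x ≠ α * y := fun h => hxy (mul_left_cancel₀ hα h)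
  refine ⟨ConfluentH2.ratFun, ConfluentH2.exactFun a b c α x y, fun _ => Iff.rfl, fun _ => Iff.rfl,
    ConfluentH2.exactFun_le_ratFun,
    ConfluentH2.finrank_ratFun_quotient (notInt ha) (notInt hb) (notInt hc) hαx hαy hαxy,
    fun f hf => ConfluentH2.exists_eq_affine_add_nablaOp (notInt ha) (notInt hb) (notInt hc)
      hαx hαy hαxy hf, ?_⟩
  rintro c₀ c₁ c₂ ⟨g, h, hg, hh, heq⟩
  exact ConfluentH2.eq_zero_of_affine_eq_nablaOp (notInt ha) (notInt hb) (notInt hc)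
    hαx hαy hαxy hg hh heq
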